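/- For every ν ≥ 0 and every x > ν, (1 − (ν² − 1/4)/x²) − V_{θup_ν}(x) = (x² + 4ν²)/(4(x² − ν²)²); in particular V_{θup_ν}(x) < 1 − (ν² − 1/4)/x² for all x > ν. -/

import Mathlib

/-- The potential `V_f` associated with a function `f` via Liouville's transformation. -/
noncomputable def potential (f : ℝ → ℝ) (x : ℝ) : ℝ :=
  (deriv f x) ^ 2 + (1 / 2) * (deriv (deriv (deriv f)) x / deriv f x)
    - (3 / 4) * (deriv (deriv f) x / deriv f x) ^ 2

/-- The upper bound for the Bessel phase function:
`θup_ν(x) := √(x² − ν²) − ν·arccos(ν/x) − π/4`. -/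
noncomputable def thetaUp (ν x : ℝ) : ℝ :=
  Real.sqrt (x ^ 2 - ν ^ 2) - ν * Real.arccos (ν / x) - Real.pi / 4

lemma hasDerivAt_sqrt_sq_sub_sq {ν x : ℝ} (hν : 0 ≤ ν) (hx : ν < x) :
    HasDerivAt (fun y => Real.sqrt (y ^ 2 - ν ^ 2)) (x / Real.sqrt (x ^ 2 - ν ^ 2)) x := by
  have hpos : 0 < x ^ 2 - ν ^ 2 := by nlinarith
  have h := (((hasDerivAt_id x).pow 2).sub_const (ν ^ 2)).sqrt (by simpa using hpos.ne')
  convert! h using 1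
  have hs := Real.sqrt_pos.mpr hpos
  simp
  field_simp

lemma hasDerivAt_thetaUp {ν x : ℝ} (hν : 0 ≤ ν) (hx : ν < x) :
    HasDerivAt (thetaUp ν) (Real.sqrt (x ^ 2 - ν ^ 2) / x) x := by
  have hx0 : 0 < x := hν.trans_lt hx
  have hpos : 0 < x ^ 2 - ν ^ 2 := by nlinarith
  have hs := Real.sqrt_pos.mpr hpos
  have hlt : ν / x < 1 := (div_lt_one hx0).mpr hx
  have hnn : 0 ≤ ν / x := div_nonneg hν hx0.le
  have hdiv : HasDerivAt (fun y : ℝ => ν / y) (-ν / x ^ 2) x := by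
    convert! (hasDerivAt_const x ν).div (hasDerivAt_id x) hx0.ne' using 1
    simp
  have harc := (Real.hasDerivAt_arccos (by linarith) hlt.ne).comp x hdiv
  have h := ((hasDerivAt_sqrt_sq_sub_sq hν hx).sub (harc.const_mul ν)).sub_const (Real.pi / 4)
  have hsqrt : Real.sqrt (1 - (ν / x) ^ 2) = Real.sqrt (x ^ 2 - ν ^ 2) / x := by
    rw [show 1 - (ν / x) ^ 2 = (x ^ 2 - ν ^ 2) / x ^ 2 by field_simp,
      Real.sqrt_div hpos.le, Real.sqrt_sq hx0.le]
  convert! h using 1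
  rw [hsqrt]
  have hsq := Real.sq_sqrt hpos.le
  field_simp
  linear_combination hsq

lemma deriv_eq_of_hasDerivAt_Ioi {f g : ℝ → ℝ} {a x k : ℝ} (hx : a < x)
    (hfg : ∀ y, a < y → f y = g y) (hg : HasDerivAt g k x) : deriv f x = k :=
  (hg.congr_of_eventuallyEq ((eventually_gt_nhds hx).mono hfg)).deriv

lemma deriv_deriv_thetaUp {ν x : ℝ} (hν : 0 ≤ ν) (hx : ν < x) :
    deriv (deriv (thetaUp ν)) x = ν ^ 2 / (x ^ 2 * Real.sqrt (x ^ 2 - ν ^ 2)) := by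
  have hx0 : 0 < x := hν.trans_lt hx
  have hpos : 0 < x ^ 2 - ν ^ 2 := by nlinarith
  have hs := Real.sqrt_pos.mpr hpos
  refine deriv_eq_of_hasDerivAt_Ioi hx (fun y hy => (hasDerivAt_thetaUp hν hy).deriv) ?_
  convert! (hasDerivAt_sqrt_sq_sub_sq hν hx).div (hasDerivAt_id x) hx0.ne' using 1
  have hsq := Real.sq_sqrt hpos.le
  simp only [id]
  field_simp
  linear_combination hsq

lemma deriv_deriv_deriv_thetaUp {ν x : ℝ} (hν : 0 ≤ ν) (hx : ν < x) :
    deriv (deriv (deriv (thetaUp ν))) x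
      = -ν ^ 2 * (3 * x ^ 2 - 2 * ν ^ 2) / (x ^ 3 * Real.sqrt (x ^ 2 - ν ^ 2) ^ 3) := by
  have hx0 : 0 < x := hν.trans_lt hx
  have hpos : 0 < x ^ 2 - ν ^ 2 := by nlinarith
  have hs := Real.sqrt_pos.mpr hpos
  refine deriv_eq_of_hasDerivAt_Ioi hx (fun y hy => deriv_deriv_thetaUp hν hy) ?_
  convert! (hasDerivAt_const x (ν ^ 2)).div
    (((hasDerivAt_id x).pow 2).mul (hasDerivAt_sqrt_sq_sub_sq hν hx)) ?_ using 1
  · have hsq := Real.sq_sqrt hpos.le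
    simp
    field_simp
    linear_combination 2 * ν ^ 2 * hsq
  · simpa using ⟨hx0.ne', hs.ne'⟩

/-- The difference between the Bessel potential and the potential of `θup_ν`:
`(1 − (ν² − 1/4)/x²) − V_{θup_ν}(x) = (x² + 4ν²)/(4(x² − ν²)²) > 0`. -/
theorem bessel_potential_sub_thetaUp_potential (ν : ℝ) (hν : 0 ≤ ν) :
    ∀ x, ν < x →
      (1 - (ν ^ 2 - 1 / 4) / x ^ 2) - potential (thetaUp ν) x
        = (x ^ 2 + 4 * ν ^ 2) / (4 * (x ^ 2 - ν ^ 2) ^ 2) ∧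
      potential (thetaUp ν) x < 1 - (ν ^ 2 - 1 / 4) / x ^ 2 := by
  intro x hx
  have hx0 : 0 < x := hν.trans_lt hx
  have hpos : 0 < x ^ 2 - ν ^ 2 := by nlinarith
  have hs := Real.sqrt_pos.mpr hpos
  have hsq := Real.sq_sqrt hpos.le
  have key : (1 - (ν ^ 2 - 1 / 4) / x ^ 2) - potential (thetaUp ν) x
      = (x ^ 2 + 4 * ν ^ 2) / (4 * (x ^ 2 - ν ^ 2) ^ 2) := by
    rw [potential, (hasDerivAt_thetaUp hν hx).deriv, deriv_deriv_thetaUp hν hx,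
      deriv_deriv_deriv_thetaUp hν hx]
    have h3 : -ν ^ 2 * (3 * x ^ 2 - 2 * ν ^ 2) / (x ^ 3 * Real.sqrt (x ^ 2 - ν ^ 2) ^ 3)
        / (Real.sqrt (x ^ 2 - ν ^ 2) / x)
        = -ν ^ 2 * (3 * x ^ 2 - 2 * ν ^ 2) / (x ^ 2 * (x ^ 2 - ν ^ 2) ^ 2) := by
      nth_rewrite 3 [← hsq]
      field_simp
    have h2 : ν ^ 2 / (x ^ 2 * Real.sqrt (x ^ 2 - ν ^ 2)) / (Real.sqrt (x ^ 2 - ν ^ 2) / x)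
        = ν ^ 2 / (x * (x ^ 2 - ν ^ 2)) := by
      nth_rewrite 3 [← hsq]
      field_simp
    rw [h3, h2, div_pow, hsq]
    field_simp
    ring
  refine ⟨key, sub_pos.mp ?_⟩
  rw [key]
  positivity
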